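/- arXiv:math-ph/0506072 — 2 statements merged into one kernel-verified Lean document; each statement's English description precedes it below -/
import Mathlib

section
/- Let f0 : Ω → ℂ be a twice continuously differentiable nonvanishing complex-valued function on a domain Ω ⊆ ℝ², and let W = W₁ + W₂·k (W₁, W₂ : Ω → ℂ twice continuously differentiable) be a solution of the bicomplex Vekua equation ∂̄W = (∂̄f0/f0)·W̄ in Ω. Then W₂ = Vec(W) is a solution of the associated Schrödinger equation −ΔW₂ + ν₂·W₂ = 0 in Ω, where ν₂ = 2·((∂f0/∂x)² + (∂f0/∂y)²)/f0² − Δf0/f0 (i.e. ν₂ = 2·(∂̄f0·∂f0)/f0² − ν₁ with ν₁ = Δf0/f0). -/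
open MeasureTheory

/-- Bicomplex numbers: `q = q0 + q1·k` with `q0, q1 : ℂ`, `k² = -1`, `ik = ki`. -/
structure Bicomplex : Type where
  re : ℂ
  im : ℂ

namespace Bicomplex

instance : Zero Bicomplex := ⟨⟨0, 0⟩⟩
instance : One Bicomplex := ⟨⟨1, 0⟩⟩
instance : Add Bicomplex := ⟨fun p q => ⟨p.re + q.re, p.im + q.im⟩⟩
instance : Neg Bicomplex := ⟨fun p => ⟨-p.re, -p.im⟩⟩
instance : Sub Bicomplex := ⟨fun p q => ⟨p.re - q.re, p.im - q.im⟩⟩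
instance : Mul Bicomplex := ⟨fun p q => ⟨p.re * q.re - p.im * q.im, p.re * q.im + p.im * q.re⟩⟩

/-- bicomplex conjugation `q0 + q1·k ↦ q0 - q1·k` -/
def conj (q : Bicomplex) : Bicomplex := ⟨q.re, -q.im⟩

/-- the second imaginary unit `k` -/
def k : Bicomplex := ⟨0, 1⟩

/-- embedding of ℂ into the bicomplex numbers -/
def ofC (z : ℂ) : Bicomplex := ⟨z, 0⟩

/-- bicomplex inverse: `q⁻¹ = q̄/(q0² + q1²)` (junk value if not invertible) -/
noncomputable def inv (q : Bicomplex) : Bicomplex :=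
  ⟨q.re / (q.re ^ 2 + q.im ^ 2), -q.im / (q.re ^ 2 + q.im ^ 2)⟩

/-- the set 𝔖 of bicomplex zero divisors: nonzero `q` with `q·q̄ = q0² + q1² = 0` -/
def zeroDivSet : Set Bicomplex := {q | q ≠ 0 ∧ q.re ^ 2 + q.im ^ 2 = 0}

end Bicomplex

/-- ∂/∂x of a complex-valued function on ℝ² -/
noncomputable def pdx (f : ℝ × ℝ → ℂ) (p : ℝ × ℝ) : ℂ := deriv (fun t => f (t, p.2)) p.1
/-- ∂/∂y of a complex-valued function on ℝ² -/
noncomputable def pdy (f : ℝ × ℝ → ℂ) (p : ℝ × ℝ) : ℂ := deriv (fun t => f (p.1, t)) p.2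
/-- Laplacian Δ = ∂²/∂x² + ∂²/∂y² of a complex-valued function on ℝ² -/
noncomputable def lap (f : ℝ × ℝ → ℂ) (p : ℝ × ℝ) : ℂ := pdx (pdx f) p + pdy (pdy f) p

/-- ∂/∂x of a bicomplex-valued function on ℝ² (componentwise) -/
noncomputable def bpdx (F : ℝ × ℝ → Bicomplex) (p : ℝ × ℝ) : Bicomplex :=
  ⟨pdx (fun q => (F q).re) p, pdx (fun q => (F q).im) p⟩
/-- ∂/∂y of a bicomplex-valued function on ℝ² (componentwise) -/
noncomputable def bpdy (F : ℝ × ℝ → Bicomplex) (p : ℝ × ℝ) : Bicomplex :=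
  ⟨pdy (fun q => (F q).re) p, pdy (fun q => (F q).im) p⟩

/-- `∂̄ = ∂/∂x + k·∂/∂y` -/
noncomputable def dbar (F : ℝ × ℝ → Bicomplex) (p : ℝ × ℝ) : Bicomplex :=
  bpdx F p + Bicomplex.k * bpdy F p

/-- `∂ = ∂/∂x − k·∂/∂y` -/
noncomputable def dz (F : ℝ × ℝ → Bicomplex) (p : ℝ × ℝ) : Bicomplex :=
  bpdx F p - Bicomplex.k * bpdy F p

/-- continuity of a bicomplex-valued function (componentwise) -/
def BContinuousOn (F : ℝ × ℝ → Bicomplex) (Ω : Set (ℝ × ℝ)) : Prop :=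
  ContinuousOn (fun p => (F p).re) Ω ∧ ContinuousOn (fun p => (F p).im) Ω

/-- `C^n` smoothness of a bicomplex-valued function (componentwise) -/
def BContDiffOn (n : ℕ∞) (F : ℝ × ℝ → Bicomplex) (Ω : Set (ℝ × ℝ)) : Prop :=
  ContDiffOn ℝ n (fun p => (F p).re) Ω ∧ ContDiffOn ℝ n (fun p => (F p).im) Ω

/-- characteristic coefficient `a_(F,G)` -/
noncomputable def aCoef (F G : ℝ × ℝ → Bicomplex) (z : ℝ × ℝ) : Bicomplex :=
  -((Bicomplex.conj (F z) * dbar G z - dbar F z * Bicomplex.conj (G z)) *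
    Bicomplex.inv (F z * Bicomplex.conj (G z) - Bicomplex.conj (F z) * G z))
/-- characteristic coefficient `b_(F,G)` -/
noncomputable def bCoef (F G : ℝ × ℝ → Bicomplex) (z : ℝ × ℝ) : Bicomplex :=
  (F z * dbar G z - dbar F z * G z) *
    Bicomplex.inv (F z * Bicomplex.conj (G z) - Bicomplex.conj (F z) * G z)
/-- characteristic coefficient `A_(F,G)` -/
noncomputable def ACoef (F G : ℝ × ℝ → Bicomplex) (z : ℝ × ℝ) : Bicomplex :=
  -((Bicomplex.conj (F z) * dz G z - dz F z * Bicomplex.conj (G z)) *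
    Bicomplex.inv (F z * Bicomplex.conj (G z) - Bicomplex.conj (F z) * G z))
/-- characteristic coefficient `B_(F,G)` -/
noncomputable def BCoef (F G : ℝ × ℝ → Bicomplex) (z : ℝ × ℝ) : Bicomplex :=
  (F z * dz G z - dz F z * G z) *
    Bicomplex.inv (F z * Bicomplex.conj (G z) - Bicomplex.conj (F z) * G z)

/-- `(F,G)` is a generating pair on `Ω` -/
def IsGeneratingPair (F G : ℝ × ℝ → Bicomplex) (Ω : Set (ℝ × ℝ)) : Prop :=
  BContDiffOn 1 F Ω ∧ BContDiffOn 1 G Ω ∧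
    ∀ z ∈ Ω, (Bicomplex.conj (F z) * G z).im ≠ 0

/-- `∂̄f0/f0 = (∂f0/∂x)/f0 + k·(∂f0/∂y)/f0` as a bicomplex-valued function -/
noncomputable def dbarLogQuot (f0 : ℝ × ℝ → ℂ) (p : ℝ × ℝ) : Bicomplex :=
  ⟨pdx f0 p / f0 p, pdy f0 p / f0 p⟩

open scoped Topology

section PartialDerivatives

variable {f g : ℝ × ℝ → ℂ} {p : ℝ × ℝ}

theorem DifferentiableAt.hasDerivAt_slice_fst (hf : DifferentiableAt ℝ f p) :
    HasDerivAt (fun t => f (t, p.2)) (fderiv ℝ f p (1, 0)) p.1 :=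
  HasFDerivAt.comp_hasDerivAt (f := fun t : ℝ => (t, p.2)) p.1 hf.hasFDerivAt
    ((hasDerivAt_id p.1).prodMk (hasDerivAt_const p.1 p.2))

theorem DifferentiableAt.hasDerivAt_slice_snd (hf : DifferentiableAt ℝ f p) :
    HasDerivAt (fun t => f (p.1, t)) (fderiv ℝ f p (0, 1)) p.2 :=
  HasFDerivAt.comp_hasDerivAt (f := fun t : ℝ => (p.1, t)) p.2 hf.hasFDerivAt
    ((hasDerivAt_const p.2 p.1).prodMk (hasDerivAt_id p.2))

theorem pdx_eq_fderiv (hf : DifferentiableAt ℝ f p) : pdx f p = fderiv ℝ f p (1, 0) :=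
  hf.hasDerivAt_slice_fst.deriv

theorem pdy_eq_fderiv (hf : DifferentiableAt ℝ f p) : pdy f p = fderiv ℝ f p (0, 1) :=
  hf.hasDerivAt_slice_snd.deriv

theorem Filter.EventuallyEq.pdx_eq (h : f =ᶠ[𝓝 p] g) : pdx f p = pdx g p :=
  (h.comp_tendsto (Continuous.prodMk_left p.2).continuousAt).deriv_eq

theorem Filter.EventuallyEq.pdy_eq (h : f =ᶠ[𝓝 p] g) : pdy f p = pdy g p :=
  (h.comp_tendsto (Continuous.prodMk_right p.1).continuousAt).deriv_eq

theorem pdx_add (hf : DifferentiableAt ℝ f p) (hg : DifferentiableAt ℝ g p) :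
    pdx (f + g) p = pdx f p + pdx g p := by
  simp [pdx_eq_fderiv, hf, hg, hf.add hg, fderiv_add]

theorem pdy_add (hf : DifferentiableAt ℝ f p) (hg : DifferentiableAt ℝ g p) :
    pdy (f + g) p = pdy f p + pdy g p := by
  simp [pdy_eq_fderiv, hf, hg, hf.add hg, fderiv_add]

theorem pdy_sub (hf : DifferentiableAt ℝ f p) (hg : DifferentiableAt ℝ g p) :
    pdy (f - g) p = pdy f p - pdy g p := by
  simp [pdy_eq_fderiv, hf, hg, hf.sub hg, fderiv_sub]

theorem pdx_mul (hf : DifferentiableAt ℝ f p) (hg : DifferentiableAt ℝ g p) :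
    pdx (f * g) p = pdx f p * g p + f p * pdx g p := by
  rw [pdx_eq_fderiv (hf.mul hg), pdx_eq_fderiv hf, pdx_eq_fderiv hg, fderiv_mul hf hg]
  simp
  ring

theorem pdy_mul (hf : DifferentiableAt ℝ f p) (hg : DifferentiableAt ℝ g p) :
    pdy (f * g) p = pdy f p * g p + f p * pdy g p := by
  rw [pdy_eq_fderiv (hf.mul hg), pdy_eq_fderiv hf, pdy_eq_fderiv hg, fderiv_mul hf hg]
  simp
  ring

theorem ContDiffAt.eventually_differentiableAt_two (hf : ContDiffAt ℝ 2 f p) :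
    ∀ᶠ q in 𝓝 p, DifferentiableAt ℝ f q :=
  (hf.eventually (by simp)).mono fun _ hq => hq.differentiableAt (by simp)

theorem ContDiffAt.pdx_eventuallyEq (hf : ContDiffAt ℝ 2 f p) :
    pdx f =ᶠ[𝓝 p] fun q => fderiv ℝ f q (1, 0) :=
  hf.eventually_differentiableAt_two.mono fun _ hq => pdx_eq_fderiv hq

theorem ContDiffAt.pdy_eventuallyEq (hf : ContDiffAt ℝ 2 f p) :
    pdy f =ᶠ[𝓝 p] fun q => fderiv ℝ f q (0, 1) :=
  hf.eventually_differentiableAt_two.mono fun _ hq => pdy_eq_fderiv hq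

theorem ContDiffAt.differentiableAt_fderiv_two (hf : ContDiffAt ℝ 2 f p) :
    DifferentiableAt ℝ (fderiv ℝ f) p :=
  (hf.fderiv_right (m := 1) (by norm_num)).differentiableAt (by simp)

theorem ContDiffAt.differentiableAt_pdx (hf : ContDiffAt ℝ 2 f p) :
    DifferentiableAt ℝ (pdx f) p :=
  (hf.differentiableAt_fderiv_two.clm_apply (differentiableAt_const _)).congr_of_eventuallyEq
    hf.pdx_eventuallyEq

theorem ContDiffAt.differentiableAt_pdy (hf : ContDiffAt ℝ 2 f p) :
    DifferentiableAt ℝ (pdy f) p :=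
  (hf.differentiableAt_fderiv_two.clm_apply (differentiableAt_const _)).congr_of_eventuallyEq
    hf.pdy_eventuallyEq

/-- Mixed second partial derivatives of a `C²` function agree. -/
theorem ContDiffAt.pdx_pdy_comm (hf : ContDiffAt ℝ 2 f p) : pdx (pdy f) p = pdy (pdx f) p := by
  have hd := hf.differentiableAt_fderiv_two
  rw [hf.pdy_eventuallyEq.pdx_eq, hf.pdx_eventuallyEq.pdy_eq,
    pdx_eq_fderiv (hd.clm_apply (differentiableAt_const _)),
    pdy_eq_fderiv (hd.clm_apply (differentiableAt_const _)),
    fderiv_clm_apply hd (differentiableAt_const _),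
    fderiv_clm_apply hd (differentiableAt_const _)]
  simpa using (hf.isSymmSndFDerivAt (by simp)).eq (1, 0) (0, 1)

end PartialDerivatives

/-- The real system equivalent to the Vekua equation `∂̄W = (∂̄f/f)·W̄` at a point where
`f` does not vanish, with denominators cleared. -/
theorem vekua_system {f u v : ℝ × ℝ → ℂ} {p : ℝ × ℝ} (hf : f p ≠ 0)
    (h : dbar (fun q => (⟨u q, v q⟩ : Bicomplex)) p =
      dbarLogQuot f p * Bicomplex.conj ⟨u p, v p⟩) :
    f p * pdx u p - pdx f p * u p = f p * pdy v p + pdy f p * v p ∧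
      f p * pdy u p - pdy f p * u p = -(f p * pdx v p + pdx f p * v p) := by
  have hre : pdx u p + (0 * pdy u p - 1 * pdy v p) =
      pdx f p / f p * u p - pdy f p / f p * -v p := congrArg Bicomplex.re h
  have him : pdx v p + (0 * pdy v p + 1 * pdy u p) =
      pdx f p / f p * -v p + pdy f p / f p * u p := congrArg Bicomplex.im h
  field_simp at hre him
  constructor
  · linear_combination hre
  · linear_combination him

/-- if `W = W₁ + W₂·k` solves `∂̄W = (∂̄f0/f0)·W̄` in Ω then `W₂ = Vec W`
solves the associated Schrödinger equation `−ΔW₂ + ν₂W₂ = 0` with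
`ν₂ = 2((∂f0/∂x)² + (∂f0/∂y)²)/f0² − Δf0/f0`. -/
theorem vector_part_solves_associated_Schroedinger
    (Ω : Set (ℝ × ℝ)) (hΩo : IsOpen Ω) (hΩc : IsConnected Ω)
    (f0 : ℝ × ℝ → ℂ) (hf0 : ContDiffOn ℝ 2 f0 Ω) (hf0ne : ∀ p ∈ Ω, f0 p ≠ 0)
    (W₁ W₂ : ℝ × ℝ → ℂ)
    (hW₁ : ContDiffOn ℝ 2 W₁ Ω) (hW₂ : ContDiffOn ℝ 2 W₂ Ω)
    (hVek : ∀ p ∈ Ω,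
      dbar (fun q => (⟨W₁ q, W₂ q⟩ : Bicomplex)) p =
        dbarLogQuot f0 p * Bicomplex.conj ⟨W₁ p, W₂ p⟩) :
    ∀ p ∈ Ω,
      -lap W₂ p +
        (2 * ((pdx f0 p) ^ 2 + (pdy f0 p) ^ 2) / (f0 p) ^ 2 - lap f0 p / f0 p) * W₂ p
        = 0 := by
  intro p hp
  have hΩ : Ω ∈ 𝓝 p := hΩo.mem_nhds hp
  have hf := hf0.contDiffAt hΩ
  have hu := hW₁.contDiffAt hΩ
  have hv := hW₂.contDiffAt hΩ
  have df := hf.differentiableAt two_ne_zero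
  have du := hu.differentiableAt two_ne_zero
  have dv := hv.differentiableAt two_ne_zero
  have dfx := hf.differentiableAt_pdx
  have dfy := hf.differentiableAt_pdy
  have dux := hu.differentiableAt_pdx
  have duy := hu.differentiableAt_pdy
  have dvx := hv.differentiableAt_pdx
  have dvy := hv.differentiableAt_pdy
  have hre : f0 * pdx W₁ - pdx f0 * W₁ =ᶠ[𝓝 p] f0 * pdy W₂ + pdy f0 * W₂ :=
    Filter.mem_of_superset hΩ fun q hq => (vekua_system (hf0ne q hq) (hVek q hq)).1
  have him : f0 * pdy W₁ + (f0 * pdx W₂ + pdx f0 * W₂) =ᶠ[𝓝 p] pdy f0 * W₁ :=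
    Filter.mem_of_superset hΩ fun q hq => by
      have h := (vekua_system (hf0ne q hq) (hVek q hq)).2
      change f0 q * pdy W₁ q + (f0 q * pdx W₂ q + pdx f0 q * W₂ q) = pdy f0 q * W₁ q
      linear_combination h
  have hy := hre.pdy_eq
  have hx := him.pdx_eq
  rw [pdy_sub (df.mul dux) (dfx.mul du), pdy_add (df.mul dvy) (dfy.mul dv), pdy_mul df dux,
    pdy_mul dfx du, pdy_mul df dvy, pdy_mul dfy dv] at hy
  rw [pdx_add (df.mul duy) ((df.mul dvx).add (dfx.mul dv)), pdx_add (df.mul dvx) (dfx.mul dv),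
    pdx_mul df duy, pdx_mul df dvx, pdx_mul dfx dv, pdx_mul dfy du,
    hu.pdx_pdy_comm, hf.pdx_pdy_comm] at hx
  obtain ⟨h₁, h₂⟩ := vekua_system (hf0ne p hp) (hVek p hp)
  have hne := hf0ne p hp
  unfold lap
  field_simp
  linear_combination f0 p * hy - f0 p * hx - 2 * pdy f0 p * h₁ + 2 * pdx f0 p * h₂
end

section
/- Let Ω ⊆ ℝ³ be a domain and q : Ω → ℍ(ℂ) differentiable. Let a = a₁e₁ + a₂e₂ + a₃e₃ be a purely vectorial complex-quaternion-valued function on Ω and b = B·e₂ with B bicomplex-valued (i.e. B = B₀ + B₁e₃, B₀, B₁ : Ω → ℂ). Write q = Q₁ + Q₂e₂ with bicomplex components Q₁ = q₀ + q₃e₃, Q₂ = q₂ − q₁e₃, and set 𝒜₁ = a₃e₃, 𝒜₂ = a₂ − a₁e₃, D₁ = e₃∂₃, D₂ = ∂₂ − e₃∂₁. Then the equation Dq + a·q + q·b = 0 in Ω holds if and only if D₁Q₁ − D₂Q̄₂ + 𝒜₁Q₁ − 𝒜₂Q̄₂ − B̄Q₂ = 0 and D₂Q̄₁ + D₁Q₂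 + 𝒜₂Q̄₁ + 𝒜₁Q₂ + BQ₁ = 0 in Ω, where the bar denotes the bicomplex conjugation sending e₃ to −e₃. -/
open scoped Quaternion

/-- points of ℝ³ -/
abbrev R3 := Fin 3 → ℝ

/-- partial derivative ∂ⱼ of a complex-valued function on ℝ³ -/
noncomputable def pd (j : Fin 3) (f : R3 → ℂ) (x : R3) : ℂ :=
  deriv (fun t => f (Function.update x j t)) (x j)

/-- partial derivative ∂ⱼ of a complex-quaternion-valued function (componentwise) -/
noncomputable def pdQ (j : Fin 3) (F : R3 → ℍ[ℂ]) (x : R3) : ℍ[ℂ] :=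
  ⟨pd j (fun y => (F y).re) x, pd j (fun y => (F y).imI) x,
   pd j (fun y => (F y).imJ) x, pd j (fun y => (F y).imK) x⟩

/-- quaternionic unit e₁ -/
def e₁ : ℍ[ℂ] := ⟨0, 1, 0, 0⟩
/-- quaternionic unit e₂ -/
def e₂ : ℍ[ℂ] := ⟨0, 0, 1, 0⟩
/-- quaternionic unit e₃ -/
def e₃ : ℍ[ℂ] := ⟨0, 0, 0, 1⟩

/-- the Moisil–Theodorescu (Dirac) operator `D = e₁∂₁ + e₂∂₂ + e₃∂₃` -/
noncomputable def Dmt (F : R3 → ℍ[ℂ]) (x : R3) : ℍ[ℂ] :=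
  e₁ * pdQ 0 F x + e₂ * pdQ 1 F x + e₃ * pdQ 2 F x

/-- componentwise differentiability of an ℍ(ℂ)-valued function on a set -/
def QDifferentiableOn (F : R3 → ℍ[ℂ]) (Ω : Set R3) : Prop :=
  DifferentiableOn ℝ (fun x => (F x).re) Ω ∧ DifferentiableOn ℝ (fun x => (F x).imI) Ω ∧
  DifferentiableOn ℝ (fun x => (F x).imJ) Ω ∧ DifferentiableOn ℝ (fun x => (F x).imK) Ω

/-- partial derivative ∂ⱼ of a bicomplex-valued function on ℝ³ (componentwise) -/
noncomputable def bpd (j : Fin 3) (Q : R3 → Bicomplex) (x : R3) : Bicomplex :=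
  ⟨pd j (fun y => (Q y).re) x, pd j (fun y => (Q y).im) x⟩

/-- `D₁ = e₃∂₃` -/
noncomputable def D1 (Q : R3 → Bicomplex) (x : R3) : Bicomplex :=
  Bicomplex.k * bpd 2 Q x

/-- `D₂ = ∂₂ − e₃∂₁` -/
noncomputable def D2 (Q : R3 → Bicomplex) (x : R3) : Bicomplex :=
  bpd 1 Q x - Bicomplex.k * bpd 0 Q x

/-- first bicomplex component `Q₁ = q₀ + q₃e₃` of a complex quaternion -/
def Qone (q : ℍ[ℂ]) : Bicomplex := ⟨q.re, q.imK⟩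
/-- second bicomplex component `Q₂ = q₂ − q₁e₃` of a complex quaternion -/
def Qtwo (q : ℍ[ℂ]) : Bicomplex := ⟨q.imJ, -q.imI⟩

@[ext]
theorem Bicomplex.ext {p q : Bicomplex} (hre : p.re = q.re) (him : p.im = q.im) : p = q := by
  cases p; cases q; simp_all

namespace Bicomplex

@[simp] theorem zero_re : (0 : Bicomplex).re = 0 := rfl
@[simp] theorem zero_im : (0 : Bicomplex).im = 0 := rfl
@[simp] theorem add_re (p q : Bicomplex) : (p + q).re = p.re + q.re := rfl
@[simp] theorem add_im (p q : Bicomplex) : (p + q).im = p.im + q.im := rfl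
@[simp] theorem sub_re (p q : Bicomplex) : (p - q).re = p.re - q.re := rfl
@[simp] theorem sub_im (p q : Bicomplex) : (p - q).im = p.im - q.im := rfl
@[simp] theorem mul_re (p q : Bicomplex) : (p * q).re = p.re * q.re - p.im * q.im := rfl
@[simp] theorem mul_im (p q : Bicomplex) : (p * q).im = p.re * q.im + p.im * q.re := rfl
@[simp] theorem conj_re (q : Bicomplex) : q.conj.re = q.re := rfl
@[simp] theorem conj_im (q : Bicomplex) : q.conj.im = -q.im := rfl
@[simp] theorem k_re : k.re = 0 := rfl
@[simp] theorem k_im : k.im = 1 := rfl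

end Bicomplex

/-- Both sides are junk together, so no differentiability is needed. -/
@[simp]
theorem pd_neg (j : Fin 3) (f : R3 → ℂ) (x : R3) : pd j (fun y => -f y) x = -pd j f x :=
  deriv.fun_neg

theorem eq_zero_iff_Qone_Qtwo (p : ℍ[ℂ]) : p = 0 ↔ Qone p = 0 ∧ Qtwo p = 0 := by
  simp only [Quaternion.ext_iff, Bicomplex.ext_iff, Qone, Qtwo, Bicomplex.zero_re,
    Bicomplex.zero_im, neg_eq_zero, Quaternion.re_zero, Quaternion.imI_zero,
    Quaternion.imJ_zero, Quaternion.imK_zero]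
  tauto

theorem Qone_add (p r : ℍ[ℂ]) : Qone (p + r) = Qone p + Qone r := by
  ext <;> simp [Qone]

theorem Qtwo_add (p r : ℍ[ℂ]) : Qtwo (p + r) = Qtwo p + Qtwo r := by
  ext <;> simp [Qtwo, add_comm]

theorem Qone_mul (p r : ℍ[ℂ]) : Qone (p * r) = Qone p * Qone r - Qtwo p * (Qtwo r).conj := by
  ext <;> simp [Qone, Qtwo, Quaternion.re_mul, Quaternion.imK_mul] <;> ring

theorem Qtwo_mul (p r : ℍ[ℂ]) : Qtwo (p * r) = Qone p * Qtwo r + Qtwo p * (Qone r).conj := by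
  ext <;> simp [Qone, Qtwo, Quaternion.imJ_mul, Quaternion.imI_mul] <;> ring

theorem Qone_Dmt (q : R3 → ℍ[ℂ]) (x : R3) :
    Qone (Dmt q x) = D1 (fun y => Qone (q y)) x - D2 (fun y => (Qtwo (q y)).conj) x := by
  simp only [Dmt, Qone_add, Qone_mul]
  ext <;> simp [Qone, Qtwo, pdQ, e₁, e₂, e₃, D1, D2, bpd] <;> ring

theorem Qtwo_Dmt (q : R3 → ℍ[ℂ]) (x : R3) :
    Qtwo (Dmt q x) = D2 (fun y => (Qone (q y)).conj) x + D1 (fun y => Qtwo (q y)) x := by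
  simp only [Dmt, Qtwo_add, Qtwo_mul]
  ext <;> simp [Qone, Qtwo, pdQ, e₁, e₂, e₃, D1, D2, bpd] <;> ring

/-- the quaternionic equation `Dq + a·q + q·b = 0` (with purely vectorial
`a` and `b = B·e₂`, `B` bicomplex) is equivalent to the bicomplex system
`D₁Q₁ − D₂Q̄₂ + 𝒜₁Q₁ − 𝒜₂Q̄₂ − B̄Q₂ = 0`, `D₂Q̄₁ + D₁Q₂ + 𝒜₂Q̄₁ + 𝒜₁Q₂ + BQ₁ = 0`. -/
theorem quaternionic_equation_as_bicomplex_system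
    (Ω : Set R3) (hΩ : IsOpen Ω)
    (q : R3 → ℍ[ℂ]) (hq : QDifferentiableOn q Ω)
    (a1 a2 a3 : R3 → ℂ) (B : R3 → Bicomplex) :
    let aq : R3 → ℍ[ℂ] := fun x => ⟨0, a1 x, a2 x, a3 x⟩
    let bq : R3 → ℍ[ℂ] := fun x => ⟨0, -(B x).im, (B x).re, 0⟩
    let Q1 : R3 → Bicomplex := fun x => Qone (q x)
    let Q2 : R3 → Bicomplex := fun x => Qtwo (q x)
    let A1 : R3 → Bicomplex := fun x => ⟨0, a3 x⟩
    let A2 : R3 → Bicomplex := fun x => ⟨a2 x, -a1 x⟩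
    (∀ x ∈ Ω, Dmt q x + aq x * q x + q x * bq x = 0) ↔
      (∀ x ∈ Ω,
        D1 Q1 x - D2 (fun y => Bicomplex.conj (Q2 y)) x + A1 x * Q1 x
            - A2 x * Bicomplex.conj (Q2 x) - Bicomplex.conj (B x) * Q2 x = 0 ∧
        D2 (fun y => Bicomplex.conj (Q1 y)) x + D1 Q2 x + A2 x * Bicomplex.conj (Q1 x)
            + A1 x * Q2 x + B x * Q1 x = 0) := by
  intro aq bq Q1 Q2 A1 A2
  refine forall₂_congr fun x _ => ?_
  rw [eq_zero_iff_Qone_Qtwo]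
  have h_one : Qone (Dmt q x + aq x * q x + q x * bq x) =
      D1 Q1 x - D2 (fun y => Bicomplex.conj (Q2 y)) x + A1 x * Q1 x
        - A2 x * Bicomplex.conj (Q2 x) - Bicomplex.conj (B x) * Q2 x := by
    simp only [Qone_add, Qone_mul, Qone_Dmt]
    ext <;> simp [Qone, Qtwo, aq, bq, Q1, Q2, A1, A2] <;> ring
  have h_two : Qtwo (Dmt q x + aq x * q x + q x * bq x) =
      D2 (fun y => Bicomplex.conj (Q1 y)) x + D1 Q2 x + A2 x * Bicomplex.conj (Q1 x)
        + A1 x * Q2 x + B x * Q1 x := by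
    simp only [Qtwo_add, Qtwo_mul, Qtwo_Dmt]
    ext <;> simp [Qone, Qtwo, aq, bq, Q1, Q2, A1, A2] <;> ring
  rw [h_one, h_two]
end
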